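/- arXiv:2512.01277 — 3 statements merged into one kernel-verified Lean document; each statement's English description precedes it below -/
import Mathlib

section
/- Let d ∈ ℕ, θ_0 ∈ ℝ, θ_1 ∈ ℝ^d, θ_2 ∈ (0,∞), and set λ_l = θ_2 π² |l|_2² + |θ_1|_2²/(4θ_2) − θ_0 for l ∈ ℕ^d; assume λ_{1_d} > 0, where 1_d = (1,…,1), so that λ_l > 0 for all l. Let α ∈ [0,∞) with α > d/2 − 1 and q ∈ [0,∞). Then there exists a constant C > 0 such that for all Δ ∈ (0, 1/2]: ∑_{l∈ℕ^d} (1 − e^{−λ_l Δ})^q λ_l^{−(1+α)} ≤ C Δ^{1+α−d/2} if 1+α−d/2 < q; ≤ C Δ^q log(1/Δ) if 1+α−d/2 = q; and ≤ C Δ^q if 1+α−d/2 > q. -/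
/-- The eigenvalue `λ_l = θ₂ π² |l|₂² + |θ₁|₂²/(4θ₂) − θ₀`. -/
noncomputable def lamOf {d : ℕ} (θ0 : ℝ) (θ1 : Fin d → ℝ) (θ2 : ℝ) (l : Fin d → ℕ+) : ℝ :=
  θ2 * Real.pi ^ 2 * (∑ k, ((l k : ℕ) : ℝ) ^ 2) + (∑ k, (θ1 k) ^ 2) / (4 * θ2) - θ0

open Finset in
/-- A nonnegative family whose terms are controlled by a function of an integer-valued level, with
controlled level sets, is summable once the weighted level sums are bounded. -/
theorem summable_and_tsum_le_of_levels {ι : Type*} {f : ι → ℝ} (hf : ∀ i, 0 ≤ f i) (g : ι → ℕ)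
    {N b : ℕ → ℝ} (hb : ∀ k, 0 ≤ b k) (hfb : ∀ i, f i ≤ b (g i))
    (hcard : ∀ (s : Finset ι) (k : ℕ), (∀ i ∈ s, g i = k) → (#s : ℝ) ≤ N k) {B : ℝ}
    (hB : ∀ n, ∑ k ∈ range n, N k * b k ≤ B) : Summable f ∧ ∑' i, f i ≤ B := by
  have key (s : Finset ι) : ∑ i ∈ s, f i ≤ B := by
    refine le_trans ?_ (hB (s.sup g + 1))
    have hmaps : ∀ i ∈ s, g i ∈ range (s.sup g + 1) := fun i hi =>
      mem_range.2 (Nat.lt_succ_of_le (le_sup hi))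
    rw [← sum_fiberwise_of_maps_to hmaps]
    refine sum_le_sum fun k _ => ?_
    calc ∑ i ∈ s with g i = k, f i ≤ ∑ i ∈ s with g i = k, b k :=
          sum_le_sum fun i hi => (mem_filter.1 hi).2 ▸ hfb i
      _ = #{i ∈ s | g i = k} * b k := by rw [sum_const, nsmul_eq_mul]
      _ ≤ N k * b k :=
          mul_le_mul_of_nonneg_right (hcard _ k fun i hi => (mem_filter.1 hi).2) (hb k)
  exact ⟨summable_of_sum_le hf key, Real.tsum_le_of_sum_le hf key⟩

theorem geom_sum_le_inv_one_sub {r : ℝ} (h0 : 0 ≤ r) (h1 : r < 1) (n : ℕ) :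
    ∑ j ∈ Finset.range n, r ^ j ≤ (1 - r)⁻¹ := by
  rw [← tsum_geometric_of_lt_one h0 h1]
  exact (summable_geometric_of_lt_one h0 h1).sum_le_tsum _ fun _ _ => pow_nonneg h0 _

theorem four_rpow_neg_lt_one {s : ℝ} (hs : 0 < s) : (4 : ℝ) ^ (-s) < 1 :=
  Real.rpow_lt_one_of_one_lt_of_neg (by norm_num) (by linarith)

/-- The dyadic sum when `q` is below the critical exponent. -/
theorem dyadic_sum_le_of_lt {γ q Δ : ℝ} (hq : 0 ≤ q) (hqγ : q < γ) (hΔ : 0 < Δ) (n : ℕ) :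
    ∑ k ∈ Finset.range n, min 1 (Δ * 4 ^ k) ^ q * ((4 : ℝ) ^ k) ^ (-γ)
      ≤ (1 - (4 : ℝ) ^ (-(γ - q)))⁻¹ * Δ ^ q := by
  calc ∑ k ∈ Finset.range n, min 1 (Δ * 4 ^ k) ^ q * ((4 : ℝ) ^ k) ^ (-γ)
      ≤ ∑ k ∈ Finset.range n, ((4 : ℝ) ^ (-(γ - q))) ^ k * Δ ^ q := by
        refine Finset.sum_le_sum fun k _ => ?_
        have h4 : (0 : ℝ) < 4 ^ k := by positivity
        calc min 1 (Δ * 4 ^ k) ^ q * ((4 : ℝ) ^ k) ^ (-γ)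
            ≤ (Δ * 4 ^ k) ^ q * ((4 : ℝ) ^ k) ^ (-γ) := by
              gcongr
              exact min_le_right _ _
          _ = ((4 : ℝ) ^ (-(γ - q))) ^ k * Δ ^ q := by
              rw [Real.mul_rpow hΔ.le h4.le, mul_assoc, ← Real.rpow_add h4,
                Real.rpow_pow_comm (by norm_num), mul_comm]
              congr 2
              ring
    _ ≤ _ := by
        rw [← Finset.sum_mul]
        gcongr
        exact geom_sum_le_inv_one_sub (by positivity) (four_rpow_neg_lt_one (by linarith)) n

/-- The dyadic sum when `q` is at least the critical exponent: `K` is the level where `Δ * 4 ^ k`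
crosses `1`. -/
theorem dyadic_sum_le_of_le {γ q Δ : ℝ} (hγ : 0 < γ) (hγq : γ ≤ q) (hΔ : 0 < Δ) {K : ℕ}
    (hK : Δ * 4 ^ K ≤ 1) (hK' : 1 ≤ Δ * 4 ^ (K + 1)) (n : ℕ) :
    ∑ k ∈ Finset.range n, min 1 (Δ * 4 ^ k) ^ q * ((4 : ℝ) ^ k) ^ (-γ)
      ≤ (∑ j ∈ Finset.range (K + 1), ((4 : ℝ) ^ (-(q - γ))) ^ j
          + (1 - (4 : ℝ) ^ (-γ))⁻¹) * Δ ^ γ := by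
  have hq : 0 ≤ q := hγ.le.trans hγq
  have hterm (k : ℕ) : ((4 : ℝ) ^ k) ^ (-γ) = (Δ * 4 ^ k) ^ (-γ) * Δ ^ γ := by
    have h4 : (0 : ℝ) < 4 ^ k := by positivity
    rw [Real.mul_rpow hΔ.le h4.le, mul_right_comm, ← Real.rpow_add hΔ]
    simp
  have hnonneg (k : ℕ) : 0 ≤ min 1 (Δ * 4 ^ k) ^ q * ((4 : ℝ) ^ k) ^ (-γ) := by positivity
  have hsub : Finset.range n ⊆ Finset.range (K + 1 + n) :=
    Finset.range_subset_range.2 (by omega)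
  refine (Finset.sum_le_sum_of_subset_of_nonneg hsub fun k _ _ => hnonneg k).trans ?_
  rw [Finset.sum_range_add, add_mul, ← Finset.sum_range_reflect, Finset.sum_mul]
  refine add_le_add (Finset.sum_le_sum fun j hj => ?_) ?_
  · have hjK : j ≤ K := Nat.lt_succ_iff.1 (Finset.mem_range.1 hj)
    have hx : Δ * 4 ^ (K + 1 - 1 - j) ≤ (4 ^ j)⁻¹ := by
      rwa [← one_div, le_div_iff₀ (by positivity), mul_assoc, ← pow_add,
        show K + 1 - 1 - j + j = K by omega]
    set x : ℝ := Δ * 4 ^ (K + 1 - 1 - j) with hxdef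
    have hx0 : 0 < x := by positivity
    calc min 1 x ^ q * ((4 : ℝ) ^ (K + 1 - 1 - j)) ^ (-γ)
        ≤ x ^ q * ((4 : ℝ) ^ (K + 1 - 1 - j)) ^ (-γ) := by
          gcongr
          exact min_le_right _ _
      _ = x ^ (q - γ) * Δ ^ γ := by
          rw [hterm, ← mul_assoc, ← hxdef, ← Real.rpow_add hx0, sub_eq_add_neg]
      _ ≤ ((4 ^ j)⁻¹) ^ (q - γ) * Δ ^ γ := by
          have := sub_nonneg.2 hγq
          gcongr
      _ = _ := by
          rw [Real.rpow_pow_comm (by norm_num), Real.rpow_neg (by positivity),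
            Real.inv_rpow (by positivity)]
  · calc ∑ j ∈ Finset.range n, min 1 (Δ * 4 ^ (K + 1 + j)) ^ q * ((4 : ℝ) ^ (K + 1 + j)) ^ (-γ)
        ≤ ∑ j ∈ Finset.range n, ((4 : ℝ) ^ (-γ)) ^ j * Δ ^ γ := by
          refine Finset.sum_le_sum fun j _ => ?_
          have hx : (4 : ℝ) ^ j ≤ Δ * 4 ^ (K + 1 + j) := by
            rw [pow_add, ← mul_assoc]
            exact le_mul_of_one_le_left (by positivity) hK'
          rw [hterm, ← mul_assoc]
          gcongr
          rw [Real.rpow_pow_comm (by norm_num)]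
          refine (mul_le_of_le_one_left (by positivity) ?_).trans ?_
          · exact Real.rpow_le_one (by positivity) (min_le_left _ _) hq
          · exact Real.rpow_le_rpow_of_nonpos (by positivity) hx (by linarith)
      _ ≤ _ := by
          rw [← Finset.sum_mul]
          gcongr
          exact geom_sum_le_inv_one_sub (by positivity) (four_rpow_neg_lt_one hγ) n

/-- There is a level at which `Δ * 4 ^ k` crosses `1`. -/
theorem exists_crossing_level {Δ : ℝ} (hΔ : 0 < Δ) (hΔ1 : Δ ≤ 1) :
    ∃ K : ℕ, Δ * 4 ^ K ≤ 1 ∧ 1 ≤ Δ * 4 ^ (K + 1) := by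
  obtain ⟨K, h1, h2⟩ := exists_nat_pow_near (one_le_inv₀ hΔ |>.2 hΔ1) (by norm_num : (1 : ℝ) < 4)
  refine ⟨K, ?_, ?_⟩
  · calc Δ * 4 ^ K ≤ Δ * Δ⁻¹ := by gcongr
      _ = 1 := mul_inv_cancel₀ hΔ.ne'
  · calc 1 = Δ * Δ⁻¹ := (mul_inv_cancel₀ hΔ.ne').symm
      _ ≤ _ := by gcongr

/-- The dyadic level of a multi-index: the binary logarithm of its largest entry. -/
noncomputable def dyadicLevel {d : ℕ} (l : Fin d → ℕ+) : ℕ :=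
  Nat.log 2 (Finset.univ.sup fun i => (l i : ℕ))

theorem lt_two_pow_dyadicLevel {d : ℕ} (l : Fin d → ℕ+) (i : Fin d) :
    (l i : ℕ) < 2 ^ (dyadicLevel l + 1) :=
  (Finset.le_sup (f := fun i => (l i : ℕ)) (Finset.mem_univ i)).trans_lt
    (Nat.lt_pow_succ_log_self (by norm_num) _)

theorem exists_two_pow_dyadicLevel_le {d : ℕ} (hd : 0 < d) (l : Fin d → ℕ+) :
    ∃ i, 2 ^ dyadicLevel l ≤ (l i : ℕ) := by
  have : Nonempty (Fin d) := ⟨⟨0, hd⟩⟩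
  obtain ⟨i, -, hi⟩ := Finset.exists_mem_eq_sup Finset.univ Finset.univ_nonempty
    fun i => (l i : ℕ)
  refine ⟨i, hi ▸ Nat.pow_log_le_self 2 ?_⟩
  rw [hi]
  exact (l i).ne_zero

theorem card_le_of_dyadicLevel_eq {d : ℕ} (s : Finset (Fin d → ℕ+)) (k : ℕ)
    (hs : ∀ l ∈ s, dyadicLevel l = k) : s.card ≤ (2 ^ (k + 1)) ^ d := by
  have hmaps : ∀ l ∈ s, (fun i => (l i : ℕ)) ∈
      Fintype.piFinset fun _ : Fin d => Finset.range (2 ^ (k + 1)) := fun l hl =>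
    Fintype.mem_piFinset.2 fun i => Finset.mem_range.2 (hs l hl ▸ lt_two_pow_dyadicLevel l i)
  have hinj : Set.InjOn (fun (l : Fin d → ℕ+) i => (l i : ℕ)) s := fun l _ l' _ h =>
    funext fun i => PNat.coe_injective (congrFun h i)
  simpa using Finset.card_le_card_of_injOn _ hmaps hinj

theorem four_pow_dyadicLevel_le_sum_sq {d : ℕ} (hd : 0 < d) (l : Fin d → ℕ+) :
    (4 : ℝ) ^ dyadicLevel l ≤ ∑ i, ((l i : ℕ) : ℝ) ^ 2 := by
  obtain ⟨i, hi⟩ := exists_two_pow_dyadicLevel_le hd l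
  have hi' : (2 : ℝ) ^ dyadicLevel l ≤ (l i : ℕ) := by exact_mod_cast hi
  calc (4 : ℝ) ^ dyadicLevel l = (2 ^ dyadicLevel l) ^ 2 := by
        rw [← pow_mul, mul_comm, pow_mul]; norm_num
    _ ≤ ((l i : ℕ) : ℝ) ^ 2 := by gcongr
    _ ≤ _ := Finset.single_le_sum (f := fun i => ((l i : ℕ) : ℝ) ^ 2)
        (fun _ _ => sq_nonneg _) (Finset.mem_univ i)

theorem sum_sq_le_four_pow_dyadicLevel {d : ℕ} (l : Fin d → ℕ+) :
    ∑ i, ((l i : ℕ) : ℝ) ^ 2 ≤ d * 4 * 4 ^ dyadicLevel l := by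
  calc ∑ i, ((l i : ℕ) : ℝ) ^ 2 ≤ ∑ _i : Fin d, (4 : ℝ) ^ (dyadicLevel l + 1) := by
        refine Finset.sum_le_sum fun i _ => ?_
        have hi : ((l i : ℕ) : ℝ) ≤ 2 ^ (dyadicLevel l + 1) := by
          exact_mod_cast (lt_two_pow_dyadicLevel l i).le
        calc ((l i : ℕ) : ℝ) ^ 2 ≤ (2 ^ (dyadicLevel l + 1)) ^ 2 := by gcongr
          _ = 4 ^ (dyadicLevel l + 1) := by rw [← pow_mul, mul_comm, pow_mul]; norm_num
    _ = _ := by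
        rw [Finset.sum_const, Finset.card_univ, Fintype.card_fin, nsmul_eq_mul, pow_succ]
        ring

/-- The eigenvalues are comparable to `|l|₂²`. -/
theorem exists_lamOf_bounds {d : ℕ} (hd : 0 < d) (θ0 : ℝ) (θ1 : Fin d → ℝ) {θ2 : ℝ}
    (hθ2 : 0 < θ2) (hpos : 0 < lamOf θ0 θ1 θ2 (fun _ : Fin d => 1)) :
    ∃ c D : ℝ, 0 < c ∧ 0 < D ∧ ∀ l : Fin d → ℕ+,
      c * ∑ i, ((l i : ℕ) : ℝ) ^ 2 ≤ lamOf θ0 θ1 θ2 l ∧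
        lamOf θ0 θ1 θ2 l ≤ D * ∑ i, ((l i : ℕ) : ℝ) ^ 2 := by
  have hd' : (1 : ℝ) ≤ d := by exact_mod_cast hd
  have ha : 0 < θ2 * Real.pi ^ 2 := by positivity
  simp only [lamOf, add_sub_assoc] at hpos ⊢
  simp only [PNat.one_coe, Nat.cast_one, one_pow, Finset.sum_const, Finset.card_univ,
    Fintype.card_fin, nsmul_eq_mul, mul_one] at hpos
  set a := θ2 * Real.pi ^ 2
  set b := (∑ k, θ1 k ^ 2) / (4 * θ2) - θ0
  have hab : 0 < a + b / d := by
    have : a + b / d = (a * d + b) / d := by field_simp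
    rw [this]
    positivity
  refine ⟨min a (a + b / d), a + |b|, lt_min ha hab, by positivity, fun l => ?_⟩
  have hS : (d : ℝ) ≤ ∑ i, ((l i : ℕ) : ℝ) ^ 2 := by
    calc (d : ℝ) = ∑ _i : Fin d, (1 : ℝ) := by simp
      _ ≤ _ := Finset.sum_le_sum fun i _ => one_le_pow₀ (by exact_mod_cast one_le (a := l i))
  set S := ∑ i, ((l i : ℕ) : ℝ) ^ 2
  have hS0 : 0 < S := by linarith
  constructor
  · rcases le_total 0 b with hb | hb
    · calc min a (a + b / d) * S ≤ a * S := by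
            gcongr
            exact min_le_left _ _
        _ ≤ a * S + b := by linarith
    · calc min a (a + b / d) * S ≤ (a + b / d) * S := by
            gcongr
            exact min_le_right _ _
        _ = a * S + b * (S / d) := by ring
        _ ≤ a * S + b := by
            have : 1 ≤ S / d := (one_le_div (by linarith)).2 hS
            nlinarith
  · nlinarith [le_abs_self b, abs_nonneg b]

/-- Reduction of the eigenvalue sum to a one-dimensional dyadic sum. -/
theorem exists_tsum_lamOf_le {d : ℕ} (hd : 0 < d) (θ0 : ℝ) (θ1 : Fin d → ℝ) {θ2 : ℝ}
    (hθ2 : 0 < θ2) (hpos : 0 < lamOf θ0 θ1 θ2 (fun _ : Fin d => 1)) {α : ℝ} (hα : 0 ≤ α)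
    {q : ℝ} (hq : 0 ≤ q) :
    ∃ A : ℝ, 0 < A ∧ ∀ Δ : ℝ, 0 < Δ → ∀ B : ℝ,
      (∀ n, ∑ k ∈ Finset.range n,
        min 1 (Δ * 4 ^ k) ^ q * ((4 : ℝ) ^ k) ^ (-(1 + α - (d : ℝ) / 2)) ≤ B) →
      Summable (fun l : Fin d → ℕ+ =>
        (1 - Real.exp (-(lamOf θ0 θ1 θ2 l) * Δ)) ^ q * (lamOf θ0 θ1 θ2 l) ^ (-(1 + α))) ∧
      (∑' l : Fin d → ℕ+,
        (1 - Real.exp (-(lamOf θ0 θ1 θ2 l) * Δ)) ^ q * (lamOf θ0 θ1 θ2 l) ^ (-(1 + α)))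
        ≤ A * B := by
  obtain ⟨c, D, hc, hD, hcD⟩ := exists_lamOf_bounds hd θ0 θ1 hθ2 hpos
  set M : ℝ := max 1 (D * (d * 4))
  have hM : 1 ≤ M := le_max_left _ _
  have hM0 : 0 < M := by linarith
  refine ⟨2 ^ d * (M ^ q * c ^ (-(1 + α))), by positivity, fun Δ hΔ B hB => ?_⟩
  have hlam (l : Fin d → ℕ+) : c * 4 ^ dyadicLevel l ≤ lamOf θ0 θ1 θ2 l :=
    (mul_le_mul_of_nonneg_left (four_pow_dyadicLevel_le_sum_sq hd l) hc.le).trans (hcD l).1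
  have hlam0 (l : Fin d → ℕ+) : 0 < lamOf θ0 θ1 θ2 l := lt_of_lt_of_le (by positivity) (hlam l)
  have hexp (l : Fin d → ℕ+) : 0 ≤ 1 - Real.exp (-(lamOf θ0 θ1 θ2 l) * Δ) := by
    have := mul_pos (hlam0 l) hΔ
    exact sub_nonneg.2 (Real.exp_le_one_iff.2 (by linarith))
  have hmin (l : Fin d → ℕ+) :
      1 - Real.exp (-(lamOf θ0 θ1 θ2 l) * Δ) ≤ M * min 1 (Δ * 4 ^ dyadicLevel l) := by
    rw [mul_min_of_nonneg _ _ hM0.le, le_min_iff, mul_one]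
    constructor
    · linarith [Real.exp_pos (-(lamOf θ0 θ1 θ2 l) * Δ)]
    · calc 1 - Real.exp (-(lamOf θ0 θ1 θ2 l) * Δ) ≤ lamOf θ0 θ1 θ2 l * Δ := by
            linarith [Real.add_one_le_exp (-(lamOf θ0 θ1 θ2 l) * Δ)]
        _ ≤ (D * (d * 4 * 4 ^ dyadicLevel l)) * Δ := by
            gcongr
            exact (hcD l).2.trans
              (mul_le_mul_of_nonneg_left (sum_sq_le_four_pow_dyadicLevel l) hD.le)
        _ = (D * (d * 4)) * (Δ * 4 ^ dyadicLevel l) := by ring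
        _ ≤ _ := by
            gcongr
            exact le_max_right _ _
  refine summable_and_tsum_le_of_levels
    (fun l => mul_nonneg (Real.rpow_nonneg (hexp l) _) (Real.rpow_nonneg (hlam0 l).le _))
    dyadicLevel (N := fun k => (2 ^ (k + 1)) ^ d)
    (b := fun k => M ^ q * c ^ (-(1 + α)) *
      (min 1 (Δ * 4 ^ k) ^ q * ((4 : ℝ) ^ k) ^ (-(1 + α))))
    (fun k => by positivity) (fun l => ?_)
    (fun s k hs => by exact_mod_cast card_le_of_dyadicLevel_eq s k hs) (fun n => ?_)
  · calc _ ≤ (M * min 1 (Δ * 4 ^ dyadicLevel l)) ^ q * (c * 4 ^ dyadicLevel l) ^ (-(1 + α)) :=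
          mul_le_mul (Real.rpow_le_rpow (hexp l) (hmin l) hq)
            (Real.rpow_le_rpow_of_nonpos (by positivity) (hlam l) (by linarith))
            (Real.rpow_nonneg (hlam0 l).le _) (by positivity)
      _ = _ := by
          rw [Real.mul_rpow hM0.le (by positivity), Real.mul_rpow hc.le (by positivity)]
          ring
  · refine le_trans (le_of_eq ?_) (mul_le_mul_of_nonneg_left (hB n) (by positivity))
    rw [Finset.mul_sum]
    refine Finset.sum_congr rfl fun k _ => ?_
    have h4 : ((4 : ℝ) ^ k) ^ (-(1 + α - (d : ℝ) / 2)) =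
        (2 ^ k) ^ d * ((4 : ℝ) ^ k) ^ (-(1 + α)) := by
      have h2 : ((4 : ℝ) ^ k) ^ ((d : ℝ) / 2) = (2 ^ k) ^ d := by
        have : (4 : ℝ) ^ k = (2 ^ k) ^ (2 : ℝ) := by
          rw [Real.rpow_two, ← pow_mul, mul_comm, pow_mul]; norm_num
        rw [this, ← Real.rpow_mul (by positivity), mul_div_cancel₀ _ (by norm_num),
          Real.rpow_natCast]
      rw [← h2, ← Real.rpow_add (by positivity)]
      congr 1
      ring
    rw [h4, pow_succ, mul_pow]
    ring

/-- bounds for `𝒮_{1,n}(α,q) = ∑_l (1−e^{−λ_l Δ})^q λ_l^{−(1+α)}`, according to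
the position of `1+α−d/2` relative to `q`. -/
theorem stmt7 (d : ℕ) (hd : 0 < d) (θ0 : ℝ) (θ1 : Fin d → ℝ) (θ2 : ℝ) (hθ2 : 0 < θ2)
    (hpos : 0 < lamOf θ0 θ1 θ2 (fun _ : Fin d => 1))
    (α : ℝ) (hα0 : 0 ≤ α) (hα : (d : ℝ) / 2 - 1 < α) (q : ℝ) (hq : 0 ≤ q) :
    ∃ C : ℝ, 0 < C ∧ ∀ Δ : ℝ, 0 < Δ → Δ ≤ 1 / 2 →
      Summable (fun l : Fin d → ℕ+ =>
        (1 - Real.exp (-(lamOf θ0 θ1 θ2 l) * Δ)) ^ q * (lamOf θ0 θ1 θ2 l) ^ (-(1 + α)))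
      ∧ ((1 + α - (d : ℝ) / 2 < q →
          (∑' l : Fin d → ℕ+,
            (1 - Real.exp (-(lamOf θ0 θ1 θ2 l) * Δ)) ^ q * (lamOf θ0 θ1 θ2 l) ^ (-(1 + α)))
            ≤ C * Δ ^ (1 + α - (d : ℝ) / 2))
        ∧ (1 + α - (d : ℝ) / 2 = q →
          (∑' l : Fin d → ℕ+,
            (1 - Real.exp (-(lamOf θ0 θ1 θ2 l) * Δ)) ^ q * (lamOf θ0 θ1 θ2 l) ^ (-(1 + α)))
            ≤ C * Δ ^ q * Real.log (1 / Δ))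
        ∧ (q < 1 + α - (d : ℝ) / 2 →
          (∑' l : Fin d → ℕ+,
            (1 - Real.exp (-(lamOf θ0 θ1 θ2 l) * Δ)) ^ q * (lamOf θ0 θ1 θ2 l) ^ (-(1 + α)))
            ≤ C * Δ ^ q)) := by
  obtain ⟨A, hA, hsum⟩ := exists_tsum_lamOf_le hd θ0 θ1 hθ2 hpos hα0 hq
  have hγ : 0 < 1 + α - (d : ℝ) / 2 := by linarith
  set γ : ℝ := 1 + α - (d : ℝ) / 2
  have hinv {s : ℝ} (hs : 0 < s) : 0 < (1 - (4 : ℝ) ^ (-s))⁻¹ :=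
    inv_pos.2 (sub_pos.2 (four_rpow_neg_lt_one hs))
  rcases lt_trichotomy γ q with h | h | h
  · have h1 := hinv hγ
    have h2 := hinv (sub_pos.2 h)
    refine ⟨A * ((1 - (4 : ℝ) ^ (-(q - γ)))⁻¹ + (1 - (4 : ℝ) ^ (-γ))⁻¹), by positivity,
      fun Δ hΔ hΔ2 => ?_⟩
    obtain ⟨K, hK, hK'⟩ := exists_crossing_level hΔ (by linarith)
    obtain ⟨hs, hle⟩ := hsum Δ hΔ _ fun n =>
      (dyadic_sum_le_of_le hγ h.le hΔ hK hK' n).trans <|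
        mul_le_mul_of_nonneg_right (add_le_add_left (geom_sum_le_inv_one_sub (by positivity)
          (four_rpow_neg_lt_one (sub_pos.2 h)) (K + 1)) _) (by positivity)
    exact ⟨hs, fun _ => by rwa [mul_assoc], fun h' => absurd h' h.ne,
      fun h' => absurd h' h.not_gt⟩
  · have h1 := hinv hγ
    set c := (1 - (4 : ℝ) ^ (-γ))⁻¹
    refine ⟨A * (1 + 2 * (1 + c)), by positivity, fun Δ hΔ hΔ2 => ?_⟩
    obtain ⟨K, hK, hK'⟩ := exists_crossing_level hΔ (by linarith)
    obtain ⟨hs, hle⟩ := hsum Δ hΔ _ (dyadic_sum_le_of_le hγ h.le hΔ hK hK')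
    have hlog2 : 1 / 2 ≤ Real.log (1 / Δ) := by
      have : Real.log 2 ≤ Real.log (1 / Δ) :=
        Real.log_le_log (by norm_num) ((le_div_iff₀ hΔ).2 (by linarith))
      linarith [Real.log_two_gt_d9]
    have hlogK : (K : ℝ) ≤ Real.log (1 / Δ) := by
      have h4 : K * Real.log 4 ≤ Real.log (1 / Δ) := by
        rw [← Real.log_pow]
        exact Real.log_le_log (by positivity) ((le_div_iff₀ hΔ).2 (by linarith))
      have h5 : 1 ≤ Real.log 4 := by
        rw [show (4 : ℝ) = 2 ^ 2 by norm_num, Real.log_pow]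
        push_cast
        linarith [Real.log_two_gt_d9]
      nlinarith [(Nat.cast_nonneg K : (0 : ℝ) ≤ K)]
    refine ⟨hs, fun h' => absurd h h'.ne, fun _ => hle.trans ?_, fun h' => absurd h h'.ne'⟩
    rw [← h, sub_self, neg_zero, Real.rpow_zero]
    simp only [one_pow, Finset.sum_const, Finset.card_range, nsmul_eq_mul, mul_one]
    push_cast
    calc A * ((K + 1 + c) * Δ ^ γ)
        ≤ A * (((1 + 2 * (1 + c)) * Real.log (1 / Δ)) * Δ ^ γ) := by
          gcongr
          nlinarith
      _ = _ := by ring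
  · have h2 := hinv (sub_pos.2 h)
    refine ⟨A * (1 - (4 : ℝ) ^ (-(γ - q)))⁻¹, by positivity, fun Δ hΔ hΔ2 => ?_⟩
    obtain ⟨hs, hle⟩ := hsum Δ hΔ _ (dyadic_sum_le_of_lt hq h hΔ)
    exact ⟨hs, fun h' => absurd h' h.not_gt, fun h' => absurd h' h.ne', fun _ => by
      rwa [mul_assoc]⟩
end

section
/- Let d ∈ ℕ, θ_0 ∈ ℝ, θ_1 ∈ ℝ^d, θ_2 ∈ (0,∞), κ = θ_1/θ_2, and set λ_l = θ_2 π² |l|_2² + |θ_1|_2²/(4θ_2) − θ_0 for l ∈ ℕ^d; assume λ_{1_d} > 0, where 1_d = (1,…,1), so that λ_l > 0 for all l. Let α ∈ [0,∞) with α > d/2 − 1. For M = (M_1,…,M_d) ∈ ℕ^d let M_{(1)} = min{M_1,…,M_d} and, for j = (j_1,…,j_d) with 1 ≤ j_k ≤ M_k, let D_j = ∏_{k=1}^d [(j_k−1)/M_k, j_k/M_k]. Then there exists a constant C > 0 (depending on d, θ_0, θ_1, θ_2, α) such that for all M ∈ ℕ^d: max_j sup_{y,z∈D_j} ∑_{l∈ℕ^d}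 (e_l(y;κ) − e_l(z;κ))² λ_l^{−(1+α)} ≤ C M_{(1)}^{−(2(1+α)−d)} if 2(1+α)−d < 2; ≤ C log(1+M_{(1)}) · M_{(1)}^{−2} if 2(1+α)−d = 2; and ≤ C M_{(1)}^{−2} if 2(1+α)−d > 2. -/
/-- The eigenfunction `e_l(y;κ) = 2^{d/2} exp(−κᵀy/2) ∏_k sin(π l_k y_k)`. -/
noncomputable def eFun {d : ℕ} (l : Fin d → ℕ) (κ y : Fin d → ℝ) : ℝ :=
  (2 : ℝ) ^ ((d : ℝ) / 2) * Real.exp (-(∑ k, κ k * y k) / 2) *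
    ∏ k, Real.sin (Real.pi * (l k : ℝ) * y k)

/-- `M_{(1)} = min{M_1, …, M_d}`. -/
def minIdx {d : ℕ} (hd : 0 < d) (M : Fin d → ℕ) : ℕ :=
  Finset.univ.inf' (Finset.univ_nonempty_iff.mpr ⟨⟨0, hd⟩⟩) M

/-- The largest entry of a multi-index. -/
def maxEntry {d : ℕ} (l : Fin d → ℕ+) : ℕ :=
  Finset.univ.sup fun k => (l k : ℕ)

theorem le_maxEntry {d : ℕ} (l : Fin d → ℕ+) (k : Fin d) : (l k : ℕ) ≤ maxEntry l :=
  Finset.le_sup (f := fun k => (l k : ℕ)) (Finset.mem_univ k)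

theorem one_le_maxEntry {d : ℕ} (hd : 0 < d) (l : Fin d → ℕ+) : 1 ≤ maxEntry l :=
  (Nat.succ_le_of_lt (l ⟨0, hd⟩).pos).trans (le_maxEntry l ⟨0, hd⟩)

theorem maxEntry_sq_le_sum_sq {d : ℕ} (hd : 0 < d) (l : Fin d → ℕ+) :
    (maxEntry l : ℝ) ^ 2 ≤ ∑ k, ((l k : ℕ) : ℝ) ^ 2 := by
  have : Nonempty (Fin d) := ⟨⟨0, hd⟩⟩
  obtain ⟨k, -, hk⟩ := Finset.exists_mem_eq_sup Finset.univ Finset.univ_nonempty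
    fun k => (l k : ℕ)
  have h : maxEntry l = l k := hk
  rw [h]
  exact Finset.single_le_sum (f := fun k => ((l k : ℕ) : ℝ) ^ 2)
    (fun _ _ => sq_nonneg _) (Finset.mem_univ k)

theorem succ_pow_succ_le (k d : ℕ) :
    (k + 1) ^ (d + 1) ≤ k ^ (d + 1) + (d + 1) * (k + 1) ^ d := by
  induction d with
  | zero => simp
  | succ d ih =>
    have h : k ^ (d + 1) ≤ (k + 1) ^ (d + 1) := Nat.pow_le_pow_left (Nat.le_succ k) _
    calc (k + 1) ^ (d + 1 + 1) = (k + 1) ^ (d + 1) * k + (k + 1) ^ (d + 1) := by ring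
      _ ≤ (k ^ (d + 1) + (d + 1) * (k + 1) ^ d) * k + (k + 1) ^ (d + 1) := by gcongr
      _ ≤ (k ^ (d + 1) + (d + 1) * (k + 1) ^ d) * k + (d + 1) * (k + 1) ^ d
          + (k + 1) ^ (d + 1) := by omega
      _ = k ^ (d + 1 + 1) + (d + 1 + 1) * (k + 1) ^ (d + 1) := by ring

theorem card_filter_maxEntry_eq_le {d : ℕ} (hd : 0 < d) (u : Finset (Fin d → ℕ+)) {n : ℕ}
    (hn : 1 ≤ n) : (u.filter fun l => maxEntry l = n).card ≤ d * n ^ (d - 1) := by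
  obtain ⟨d, rfl⟩ : ∃ e, d = e + 1 := ⟨d - 1, by omega⟩
  obtain ⟨k, rfl⟩ : ∃ k, n = k + 1 := ⟨n - 1, by omega⟩
  set A : Finset (Fin (d + 1) → ℕ) := Fintype.piFinset fun _ => Finset.Icc 1 (k + 1)
  set B : Finset (Fin (d + 1) → ℕ) := Fintype.piFinset fun _ => Finset.Icc 1 k
  have hBA : B ⊆ A := Fintype.piFinset_subset _ _ fun _ =>
    Finset.Icc_subset_Icc_right (Nat.le_succ k)
  have hcard : (u.filter fun l => maxEntry l = k + 1).card ≤ (A \ B).card := by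
    refine Finset.card_le_card_of_injOn (fun l i => (l i : ℕ)) ?_ ?_
    · intro l hl
      have hl' : maxEntry l = k + 1 := (Finset.mem_filter.mp hl).2
      simp only [Finset.coe_sdiff, Set.mem_sdiff, Finset.mem_coe, A, B, Fintype.mem_piFinset,
        Finset.mem_Icc]
      refine ⟨fun i => ⟨(l i).pos, hl' ▸ le_maxEntry l i⟩, fun h => ?_⟩
      have : maxEntry l ≤ k := Finset.sup_le fun i _ => (h i).2
      omega
    · intro l _ l' _ h
      funext i
      exact PNat.coe_injective (congrFun h i)
  rw [Finset.card_sdiff_of_subset hBA] at hcard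
  have hA : A.card = (k + 1) ^ (d + 1) := by simp [A]
  have hB : B.card = k ^ (d + 1) := by simp [B]
  have := succ_pow_succ_le k d
  rw [Nat.add_sub_cancel]
  omega

theorem exists_sum_maxEntry_le {d : ℕ} (hd : 0 < d) (u : Finset (Fin d → ℕ+)) {g : ℕ → ℝ}
    (hg : ∀ n, 0 ≤ g n) :
    ∃ N : ℕ, ∑ l ∈ u, g (maxEntry l) ≤
      ∑ n ∈ Finset.Icc 1 N, (d : ℝ) * (n : ℝ) ^ (d - 1) * g n := by
  refine ⟨u.sup maxEntry, ?_⟩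
  have hmaps : ∀ l ∈ u, maxEntry l ∈ Finset.Icc 1 (u.sup maxEntry) := fun l hl =>
    Finset.mem_Icc.mpr ⟨one_le_maxEntry hd l, Finset.le_sup hl⟩
  rw [← Finset.sum_fiberwise_of_maps_to hmaps]
  refine Finset.sum_le_sum fun n hn => ?_
  rw [Finset.sum_congr rfl (g := fun _ => g n)
    (fun l hl => by rw [(Finset.mem_filter.mp hl).2]), Finset.sum_const, nsmul_eq_mul]
  refine mul_le_mul_of_nonneg_right ?_ (hg n)
  exact_mod_cast card_filter_maxEntry_eq_le hd u (Finset.mem_Icc.mp hn).1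

theorem min_mul_rpow_sub_one_le {β : ℝ} (hβ : 0 < β) (k : ℕ) :
    min 1 β * ((k : ℝ) + 1) ^ (β - 1) ≤ ((k : ℝ) + 1) ^ β - (k : ℝ) ^ β := by
  have hx : (0 : ℝ) < (k : ℝ) + 1 := by positivity
  have ht : -1 ≤ -(1 / ((k : ℝ) + 1)) := by
    rw [neg_le_neg_iff, div_le_one hx]; linarith [Nat.cast_nonneg (α := ℝ) k]
  have ht' : -(1 / ((k : ℝ) + 1)) ≤ 0 := by rw [neg_nonpos]; positivity
  have hm : 0 < min 1 β := lt_min one_pos hβ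
  have h1 : (1 + -(1 / ((k : ℝ) + 1))) ^ β ≤ 1 + min 1 β * -(1 / ((k : ℝ) + 1)) :=
    (Real.rpow_le_rpow_of_exponent_ge' (by linarith) (by linarith) hm.le (min_le_right 1 β)).trans
      (rpow_one_add_le_one_add_mul_self ht hm.le (min_le_left 1 β))
  have h2 : (k : ℝ) = ((k : ℝ) + 1) * (1 + -(1 / ((k : ℝ) + 1))) := by field_simp; ring
  have h3 : (k : ℝ) ^ β = ((k : ℝ) + 1) ^ β * (1 + -(1 / ((k : ℝ) + 1))) ^ β := by
    rw [← Real.mul_rpow hx.le (by linarith), ← h2]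
  rw [h3, Real.rpow_sub_one hx.ne']
  have := mul_le_mul_of_nonneg_left h1 (Real.rpow_nonneg hx.le β)
  calc _ = ((k : ℝ) + 1) ^ β - ((k : ℝ) + 1) ^ β * (1 + min 1 β * -(1 / ((k : ℝ) + 1))) := by
        field_simp; ring
    _ ≤ _ := by linarith

theorem sum_Icc_rpow_sub_one_le {β : ℝ} (hβ : 0 < β) (m : ℕ) :
    ∑ n ∈ Finset.Icc 1 m, (n : ℝ) ^ (β - 1) ≤ (min 1 β)⁻¹ * (m : ℝ) ^ β := by
  have hm : 0 < min 1 β := lt_min one_pos hβ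
  rw [inv_mul_eq_div, le_div_iff₀' hm]
  induction m with
  | zero => simp [Real.zero_rpow hβ.ne']
  | succ m ih =>
    rw [Finset.sum_Icc_succ_top (by omega), mul_add]
    have := min_mul_rpow_sub_one_le hβ m
    push_cast
    linarith

theorem mul_rpow_neg_one_sub_le {γ : ℝ} (hγ : 0 < γ) {k : ℕ} (hk : 1 ≤ k) :
    γ * ((k : ℝ) + 1) ^ (-1 - γ) ≤ (k : ℝ) ^ (-γ) - ((k : ℝ) + 1) ^ (-γ) := by
  have hk0 : (0 : ℝ) < k := by exact_mod_cast hk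
  have hx : (0 : ℝ) < (k : ℝ) + 1 := by positivity
  have h1 : (k : ℝ) ≤ ((k : ℝ) + 1) * Real.exp (-(1 / ((k : ℝ) + 1))) := by
    have := Real.add_one_le_exp (-(1 / ((k : ℝ) + 1)))
    calc (k : ℝ) = ((k : ℝ) + 1) * (-(1 / ((k : ℝ) + 1)) + 1) := by field_simp; ring
      _ ≤ _ := by gcongr
  have h2 := Real.rpow_le_rpow_of_nonpos hk0 h1 (neg_nonpos.mpr hγ.le)
  rw [Real.mul_rpow hx.le (Real.exp_pos _).le, ← Real.exp_mul] at h2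
  have h3 : 1 + γ / ((k : ℝ) + 1) ≤ Real.exp (-(1 / ((k : ℝ) + 1)) * -γ) := by
    have := Real.add_one_le_exp (-(1 / ((k : ℝ) + 1)) * -γ)
    calc 1 + γ / ((k : ℝ) + 1) = -(1 / ((k : ℝ) + 1)) * -γ + 1 := by ring
      _ ≤ _ := this
  have h4 := mul_le_mul_of_nonneg_left h3 (Real.rpow_nonneg hx.le (-γ))
  rw [show -1 - γ = -γ - 1 by ring, Real.rpow_sub_one hx.ne']
  calc _ = ((k : ℝ) + 1) ^ (-γ) * (1 + γ / ((k : ℝ) + 1)) - ((k : ℝ) + 1) ^ (-γ) := by ring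
    _ ≤ _ := by linarith

theorem sum_Ioc_rpow_neg_one_sub_le {γ : ℝ} (hγ : 0 < γ) {m N : ℕ} (hm : 1 ≤ m) (hN : m ≤ N) :
    ∑ n ∈ Finset.Ioc m N, (n : ℝ) ^ (-1 - γ) ≤ γ⁻¹ * (m : ℝ) ^ (-γ) := by
  rw [inv_mul_eq_div, le_div_iff₀' hγ]
  suffices h : γ * ∑ n ∈ Finset.Ioc m N, (n : ℝ) ^ (-1 - γ) ≤
      (m : ℝ) ^ (-γ) - (N : ℝ) ^ (-γ) by
    linarith [Real.rpow_nonneg (Nat.cast_nonneg (α := ℝ) N) (-γ)]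
  induction N, hN using Nat.le_induction with
  | base => simp
  | succ N hN ih =>
    rw [Finset.sum_Ioc_succ_top (by omega), mul_add]
    have := mul_rpow_neg_one_sub_le hγ (hm.trans hN)
    push_cast
    linarith

theorem sum_min_mul_rpow_le {γ : ℝ} (hγ : 0 < γ) {m : ℕ} (hm : 1 ≤ m) (N : ℕ) :
    ∑ n ∈ Finset.Icc 1 N, min 1 ((n : ℝ) ^ 2 / (m : ℝ) ^ 2) * (n : ℝ) ^ (-1 - γ) ≤
      (∑ n ∈ Finset.Icc 1 m, (n : ℝ) ^ (1 - γ)) * (m : ℝ) ^ (-(2 : ℝ)) +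
        γ⁻¹ * (m : ℝ) ^ (-γ) := by
  have hm0 : (0 : ℝ) < m := by exact_mod_cast hm
  calc _ ≤ ∑ n ∈ Finset.Icc 1 m ∪ Finset.Ioc m (max m N),
        min 1 ((n : ℝ) ^ 2 / (m : ℝ) ^ 2) * (n : ℝ) ^ (-1 - γ) := by
        refine Finset.sum_le_sum_of_subset_of_nonneg (fun n hn => ?_) fun n _ _ => by positivity
        simp only [Finset.mem_union, Finset.mem_Icc, Finset.mem_Ioc] at hn ⊢
        omega
    _ = ∑ n ∈ Finset.Icc 1 m, min 1 ((n : ℝ) ^ 2 / (m : ℝ) ^ 2) * (n : ℝ) ^ (-1 - γ) +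
        ∑ n ∈ Finset.Ioc m (max m N),
          min 1 ((n : ℝ) ^ 2 / (m : ℝ) ^ 2) * (n : ℝ) ^ (-1 - γ) := by
        refine Finset.sum_union (Finset.disjoint_left.mpr fun n h1 h2 => ?_)
        simp only [Finset.mem_Icc, Finset.mem_Ioc] at h1 h2
        omega
    _ ≤ _ := by
        refine add_le_add ?_ (le_trans (Finset.sum_le_sum fun n _ => ?_)
          (sum_Ioc_rpow_neg_one_sub_le hγ hm (le_max_left m N)))
        · rw [Finset.sum_mul]
          refine Finset.sum_le_sum fun n hn => ?_
          have hn0 : (0 : ℝ) < n := by exact_mod_cast (Finset.mem_Icc.mp hn).1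
          calc _ ≤ (n : ℝ) ^ 2 / (m : ℝ) ^ 2 * (n : ℝ) ^ (-1 - γ) := by
                gcongr; exact min_le_right _ _
            _ = _ := by
                rw [show (1 : ℝ) - γ = 2 + (-1 - γ) by ring, Real.rpow_add hn0,
                  Real.rpow_neg hm0.le, Real.rpow_two, Real.rpow_two]
                ring
        · exact mul_le_of_le_one_left (by positivity) (min_le_left _ _)

/-- The three regimes for the truncated series `∑ min(1, n²/m²) n^{-1-γ}`. -/
theorem exists_sum_min_mul_rpow_le {γ : ℝ} (hγ : 0 < γ) :
    ∃ C : ℝ, 0 < C ∧ ∀ m : ℕ, 1 ≤ m → ∃ B : ℝ,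
      (∀ N : ℕ, ∑ n ∈ Finset.Icc 1 N,
        min 1 ((n : ℝ) ^ 2 / (m : ℝ) ^ 2) * (n : ℝ) ^ (-1 - γ) ≤ B) ∧
      (γ < 2 → B ≤ C * (m : ℝ) ^ (-γ)) ∧
      (γ = 2 → B ≤ C * Real.log (1 + (m : ℝ)) * (m : ℝ) ^ (-(2 : ℝ))) ∧
      (2 < γ → B ≤ C * (m : ℝ) ^ (-(2 : ℝ))) := by
  rcases lt_trichotomy γ 2 with h | h | h
  · have hβ : 0 < 2 - γ := by linarith
    have hb : 0 < min 1 (2 - γ) := lt_min one_pos hβ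
    refine ⟨(min 1 (2 - γ))⁻¹ + γ⁻¹, by positivity, fun m hm =>
      ⟨_, sum_min_mul_rpow_le hγ hm, fun _ => ?_, fun h' => by linarith, fun h' => by linarith⟩⟩
    have hm0 : (0 : ℝ) < m := by exact_mod_cast hm
    have := sum_Icc_rpow_sub_one_le hβ m
    rw [show 2 - γ - 1 = 1 - γ by ring] at this
    calc _ ≤ (min 1 (2 - γ))⁻¹ * (m : ℝ) ^ (2 - γ) * (m : ℝ) ^ (-(2 : ℝ)) +
          γ⁻¹ * (m : ℝ) ^ (-γ) := by gcongr
      _ = _ := by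
        rw [mul_assoc, ← Real.rpow_add hm0, show 2 - γ + -2 = -γ by ring]; ring
  · subst h
    have hl2 : 0 < Real.log 2 := Real.log_pos one_lt_two
    refine ⟨(3 / 2) / Real.log 2 + 1, by positivity, fun m hm =>
      ⟨_, sum_min_mul_rpow_le hγ hm, fun h' => by linarith, fun _ => ?_, fun h' => by linarith⟩⟩
    have hm0 : (0 : ℝ) < m := by exact_mod_cast hm
    have hm1 : (1 : ℝ) ≤ m := by exact_mod_cast hm
    have hH : ∑ n ∈ Finset.Icc 1 m, (n : ℝ) ^ ((1 : ℝ) - 2) ≤ 1 + Real.log m := by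
      have := harmonic_le_one_add_log m
      simp_rw [harmonic_eq_sum_Icc, Rat.cast_sum, Rat.cast_inv, Rat.cast_natCast] at this
      norm_num [Real.rpow_neg_one]
      exact this
    have hlog : Real.log 2 ≤ Real.log (1 + m) := Real.log_le_log two_pos (by linarith)
    have hlog' : Real.log m ≤ Real.log (1 + m) := Real.log_le_log hm0 (by linarith)
    have h32 : 3 / 2 ≤ (3 / 2) / Real.log 2 * Real.log (1 + m) := by
      rw [div_mul_eq_mul_div, le_div_iff₀ hl2]; linarith
    calc _ ≤ (1 + Real.log m) * (m : ℝ) ^ (-(2 : ℝ)) + 2⁻¹ * (m : ℝ) ^ (-(2 : ℝ)) := by gcongr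
      _ = (3 / 2 + Real.log m) * (m : ℝ) ^ (-(2 : ℝ)) := by ring
      _ ≤ _ := by gcongr; linarith
  · have hs : Summable fun n : ℕ => (n : ℝ) ^ (1 - γ) :=
      Real.summable_nat_rpow.mpr (by linarith)
    have hT : 0 ≤ ∑' n : ℕ, (n : ℝ) ^ (1 - γ) := tsum_nonneg fun n => by positivity
    refine ⟨∑' n : ℕ, (n : ℝ) ^ (1 - γ) + γ⁻¹, by positivity, fun m hm =>
      ⟨_, sum_min_mul_rpow_le hγ hm, fun h' => by linarith, fun h' => by linarith, fun _ => ?_⟩⟩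
    have hm1 : (1 : ℝ) ≤ m := by exact_mod_cast hm
    have h1 : ∑ n ∈ Finset.Icc 1 m, (n : ℝ) ^ (1 - γ) ≤ ∑' n : ℕ, (n : ℝ) ^ (1 - γ) :=
      hs.sum_le_tsum _ fun n _ => by positivity
    have h2 : (m : ℝ) ^ (-γ) ≤ (m : ℝ) ^ (-(2 : ℝ)) :=
      Real.rpow_le_rpow_of_exponent_le hm1 (by linarith)
    rw [add_mul]
    gcongr

theorem abs_prod_sub_prod_le {ι : Type*} (s : Finset ι) {f g : ι → ℝ}
    (hf : ∀ i, |f i| ≤ 1) (hg : ∀ i, |g i| ≤ 1) :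
    |∏ i ∈ s, f i - ∏ i ∈ s, g i| ≤ ∑ i ∈ s, |f i - g i| := by
  classical
  induction s using Finset.induction_on with
  | empty => simp
  | insert a s ha ih =>
    rw [Finset.prod_insert ha, Finset.prod_insert ha, Finset.sum_insert ha]
    have hG : |∏ i ∈ s, g i| ≤ 1 := by
      rw [Finset.abs_prod]
      exact Finset.prod_le_one (fun i _ => abs_nonneg _) fun i _ => hg i
    calc |f a * ∏ i ∈ s, f i - g a * ∏ i ∈ s, g i|
        = |f a * (∏ i ∈ s, f i - ∏ i ∈ s, g i) + (f a - g a) * ∏ i ∈ s, g i| := by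
          congr 1; ring
      _ ≤ |f a| * |∏ i ∈ s, f i - ∏ i ∈ s, g i| + |f a - g a| * |∏ i ∈ s, g i| := by
          rw [← abs_mul, ← abs_mul]; exact abs_add_le _ _
      _ ≤ 1 * |∏ i ∈ s, f i - ∏ i ∈ s, g i| + |f a - g a| * 1 := by
          gcongr; exact hf a
      _ ≤ _ := by linarith

theorem abs_exp_sub_exp_le {a b K : ℝ} (ha : a ≤ K) (hb : b ≤ K) :
    |Real.exp a - Real.exp b| ≤ Real.exp K * |a - b| := by
  wlog h : b ≤ a generalizing a b
  · rw [abs_sub_comm, abs_sub_comm a]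
    exact this hb ha (le_of_not_ge h)
  rw [abs_of_nonneg (sub_nonneg.mpr (Real.exp_le_exp.mpr h)), abs_of_nonneg (sub_nonneg.mpr h)]
  have h1 : Real.exp b = Real.exp a * Real.exp (b - a) := by rw [← Real.exp_add]; ring_nf
  have h2 := mul_le_mul_of_nonneg_left (Real.add_one_le_exp (b - a)) (Real.exp_pos a).le
  calc Real.exp a - Real.exp b ≤ Real.exp a * (a - b) := by rw [h1]; linarith
    _ ≤ _ := mul_le_mul_of_nonneg_right (Real.exp_le_exp.mpr ha) (sub_nonneg.mpr h)

theorem exists_sq_eFun_sub_le {d : ℕ} (hd : 0 < d) (κ : Fin d → ℝ) :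
    ∃ K : ℝ, 0 < K ∧ ∀ (m : ℕ), 1 ≤ m → ∀ (l : Fin d → ℕ+) (y z : Fin d → ℝ),
      (∀ k, |y k| ≤ 1) → (∀ k, |z k| ≤ 1) → (∀ k, |y k - z k| ≤ 1 / m) →
      (eFun (fun k => (l k : ℕ)) κ y - eFun (fun k => (l k : ℕ)) κ z) ^ 2 ≤
        K * min 1 ((maxEntry l : ℝ) ^ 2 / (m : ℝ) ^ 2) := by
  set S : ℝ := ∑ k, |κ k| with hS
  have hS0 : 0 ≤ S := Finset.sum_nonneg fun _ _ => abs_nonneg _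
  set A : ℝ := (2 : ℝ) ^ ((d : ℝ) / 2) * Real.exp (S / 2) with hA
  have hA0 : 0 < A := by positivity
  set L : ℝ := S / 2 + d * Real.pi with hL
  have hL0 : 0 ≤ L := by positivity
  refine ⟨A ^ 2 * (4 + L ^ 2), by positivity, fun m hm l y z hy hz hyz => ?_⟩
  have hm0 : (0 : ℝ) < m := by exact_mod_cast hm
  have hn1 : (1 : ℝ) ≤ maxEntry l := by exact_mod_cast one_le_maxEntry hd l
  have hsin : ∀ (w : Fin d → ℝ) k, |Real.sin (Real.pi * ((l k : ℕ) : ℝ) * w k)| ≤ 1 :=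
    fun _ _ => Real.abs_sin_le_one _
  have hprod : ∀ w : Fin d → ℝ, |∏ k, Real.sin (Real.pi * ((l k : ℕ) : ℝ) * w k)| ≤ 1 := by
    intro w
    rw [Finset.abs_prod]
    exact Finset.prod_le_one (fun i _ => abs_nonneg _) fun i _ => hsin w i
  have hexp : ∀ w : Fin d → ℝ, (∀ k, |w k| ≤ 1) → -(∑ k, κ k * w k) / 2 ≤ S / 2 := by
    intro w hw
    have : |∑ k, κ k * w k| ≤ S := by
      refine (Finset.abs_sum_le_sum_abs _ _).trans (Finset.sum_le_sum fun k _ => ?_)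
      rw [abs_mul]
      exact mul_le_of_le_one_right (abs_nonneg _) (hw k)
    linarith [neg_abs_le (∑ k, κ k * w k)]
  have hbound : ∀ w : Fin d → ℝ, (∀ k, |w k| ≤ 1) →
      |eFun (fun k => (l k : ℕ)) κ w| ≤ A := by
    intro w hw
    rw [eFun, abs_mul, abs_of_pos (by positivity)]
    refine (mul_le_of_le_one_right (by positivity) (hprod w)).trans ?_
    have := hexp w hw
    rw [hA]
    gcongr
  have hlip : |eFun (fun k => (l k : ℕ)) κ y - eFun (fun k => (l k : ℕ)) κ z| ≤
      A * (L * (maxEntry l / m)) := by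
    set P := ∏ k, Real.sin (Real.pi * ((l k : ℕ) : ℝ) * y k)
    set Q := ∏ k, Real.sin (Real.pi * ((l k : ℕ) : ℝ) * z k)
    set a := -(∑ k, κ k * y k) / 2
    set b := -(∑ k, κ k * z k) / 2
    have hab : |a - b| ≤ S / 2 * (maxEntry l / m) := by
      have h1 : a - b = -(∑ k, κ k * (y k - z k)) / 2 := by
        simp only [a, b, mul_sub, Finset.sum_sub_distrib]; ring
      have h2 : |∑ k, κ k * (y k - z k)| ≤ S * (1 / m) := by
        rw [hS, Finset.sum_mul]
        refine (Finset.abs_sum_le_sum_abs _ _).trans (Finset.sum_le_sum fun k _ => ?_)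
        rw [abs_mul]
        exact mul_le_mul_of_nonneg_left (hyz k) (abs_nonneg _)
      rw [h1, abs_div, abs_neg, abs_two]
      calc _ ≤ S * (1 / m) / 2 := by gcongr
        _ = S / 2 * (1 / m) := by ring
        _ ≤ _ := by gcongr
    have hPQ : |P - Q| ≤ d * Real.pi * (maxEntry l / m) := by
      refine (abs_prod_sub_prod_le Finset.univ (hsin y) (hsin z)).trans ?_
      calc _ ≤ ∑ _k : Fin d, Real.pi * (maxEntry l / m) := by
            refine Finset.sum_le_sum fun k _ => (Real.abs_sin_sub_sin_le _ _).trans ?_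
            rw [← mul_sub, abs_mul, abs_of_nonneg (by positivity)]
            have h1 : ((l k : ℕ) : ℝ) ≤ maxEntry l := by exact_mod_cast le_maxEntry l k
            calc _ ≤ Real.pi * (maxEntry l : ℝ) * (1 / m) := by gcongr; exact hyz k
              _ = _ := by ring
        _ = _ := by simp; ring
    have h1 : |Real.exp a * P - Real.exp b * Q| ≤
        Real.exp (S / 2) * (L * (maxEntry l / m)) := by
      calc _ = |(Real.exp a - Real.exp b) * P + Real.exp b * (P - Q)| := by congr 1; ring
        _ ≤ |Real.exp a - Real.exp b| * |P| + |Real.exp b| * |P - Q| := by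
            rw [← abs_mul, ← abs_mul]; exact abs_add_le _ _
        _ ≤ Real.exp (S / 2) * |a - b| * 1 + Real.exp (S / 2) * |P - Q| := by
            rw [Real.abs_exp]
            gcongr
            · exact abs_exp_sub_exp_le (hexp y hy) (hexp z hz)
            · exact hprod y
            · exact hexp z hz
        _ ≤ Real.exp (S / 2) * (S / 2 * (maxEntry l / m)) * 1 +
            Real.exp (S / 2) * (d * Real.pi * (maxEntry l / m)) := by gcongr
        _ = _ := by rw [hL]; ring
    calc _ = |(2 : ℝ) ^ ((d : ℝ) / 2) * (Real.exp a * P - Real.exp b * Q)| := by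
          simp only [eFun]; congr 1; ring
      _ = (2 : ℝ) ^ ((d : ℝ) / 2) * |Real.exp a * P - Real.exp b * Q| := by
          rw [abs_mul, abs_of_pos (by positivity)]
      _ ≤ (2 : ℝ) ^ ((d : ℝ) / 2) * (Real.exp (S / 2) * (L * (maxEntry l / m))) := by gcongr
      _ = _ := by rw [hA]; ring
  have h2A : |eFun (fun k => (l k : ℕ)) κ y - eFun (fun k => (l k : ℕ)) κ z| ≤ 2 * A := by
    have := abs_sub (eFun (fun k => (l k : ℕ)) κ y) (eFun (fun k => (l k : ℕ)) κ z)
    linarith [hbound y hy, hbound z hz]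
  rw [← sq_abs, mul_min_of_nonneg _ _ (by positivity)]
  refine le_min ?_ ?_
  · calc _ ≤ (2 * A) ^ 2 := by gcongr
      _ ≤ _ := by nlinarith [mul_nonneg (sq_nonneg A) (sq_nonneg L)]
  · calc _ ≤ (A * (L * (maxEntry l / m))) ^ 2 := by gcongr
      _ = A ^ 2 * L ^ 2 * ((maxEntry l : ℝ) ^ 2 / (m : ℝ) ^ 2) := by
          rw [mul_pow A, mul_pow L, div_pow]; ring
      _ ≤ _ := by
          gcongr
          linarith

theorem exists_mul_sq_le_lamOf {d : ℕ} (hd : 0 < d) {θ0 : ℝ} {θ1 : Fin d → ℝ} {θ2 : ℝ}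
    (hθ2 : 0 < θ2) (hpos : 0 < lamOf θ0 θ1 θ2 (fun _ : Fin d => 1)) :
    ∃ c : ℝ, 0 < c ∧ ∀ l : Fin d → ℕ+, c * (maxEntry l : ℝ) ^ 2 ≤ lamOf θ0 θ1 θ2 l := by
  set Λ := lamOf θ0 θ1 θ2 (fun _ : Fin d => 1) with hΛ
  have hd0 : (0 : ℝ) < d := by exact_mod_cast hd
  have hc : 0 < min (θ2 * Real.pi ^ 2) (Λ / d) := lt_min (by positivity) (by positivity)
  refine ⟨_, hc, fun l => ?_⟩
  refine (mul_le_mul_of_nonneg_left (maxEntry_sq_le_sum_sq hd l) hc.le).trans ?_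
  set c := min (θ2 * Real.pi ^ 2) (Λ / d)
  have h1 : c ≤ θ2 * Real.pi ^ 2 := min_le_left _ _
  have h2 : c * d ≤ Λ := (le_div_iff₀ hd0).mp (min_le_right _ _)
  have h3 : (d : ℝ) ≤ ∑ k, ((l k : ℕ) : ℝ) ^ 2 := by
    calc (d : ℝ) = ∑ _k : Fin d, (1 : ℝ) := by simp
      _ ≤ _ := Finset.sum_le_sum fun k _ => by
          have : (1 : ℝ) ≤ ((l k : ℕ) : ℝ) := by exact_mod_cast (l k).pos
          exact one_le_pow₀ this
  have h4 : lamOf θ0 θ1 θ2 l = Λ + θ2 * Real.pi ^ 2 * (∑ k, ((l k : ℕ) : ℝ) ^ 2 - d) := by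
    rw [hΛ]
    simp only [lamOf, PNat.one_coe, Nat.cast_one, one_pow, Finset.sum_const, Finset.card_univ,
      Fintype.card_fin, nsmul_eq_mul, mul_one]
    ring
  rw [h4]
  nlinarith [mul_le_mul_of_nonneg_right h1 (sub_nonneg.mpr h3)]

/-- bounds for `𝒮_{2,M}(α) = max_j sup_{y,z∈D_j} ∑_l (e_l(y)−e_l(z))² λ_l^{−(1+α)}`
in terms of `M_{(1)}`, according to the position of `2(1+α)−d` relative to `2`. -/
theorem stmt8 (d : ℕ) (hd : 0 < d) (θ0 : ℝ) (θ1 : Fin d → ℝ) (θ2 : ℝ) (hθ2 : 0 < θ2)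
    (hpos : 0 < lamOf θ0 θ1 θ2 (fun _ : Fin d => 1))
    (α : ℝ) (hα0 : 0 ≤ α) (hα : (d : ℝ) / 2 - 1 < α) :
    ∃ C : ℝ, 0 < C ∧ ∀ M : Fin d → ℕ, (∀ k, 1 ≤ M k) →
      ∀ j : Fin d → ℕ, (∀ k, 1 ≤ j k ∧ j k ≤ M k) →
      ∀ y z : Fin d → ℝ,
        (∀ k, y k ∈ Set.Icc (((j k : ℝ) - 1) / (M k : ℝ)) ((j k : ℝ) / (M k : ℝ))) →
        (∀ k, z k ∈ Set.Icc (((j k : ℝ) - 1) / (M k : ℝ)) ((j k : ℝ) / (M k : ℝ))) →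
        Summable (fun l : Fin d → ℕ+ =>
          (eFun (fun k => (l k : ℕ)) (fun k => θ1 k / θ2) y
            - eFun (fun k => (l k : ℕ)) (fun k => θ1 k / θ2) z) ^ 2
          * (lamOf θ0 θ1 θ2 l) ^ (-(1 + α)))
        ∧ ((2 * (1 + α) - (d : ℝ) < 2 →
            (∑' l : Fin d → ℕ+,
              (eFun (fun k => (l k : ℕ)) (fun k => θ1 k / θ2) y
                - eFun (fun k => (l k : ℕ)) (fun k => θ1 k / θ2) z) ^ 2
              * (lamOf θ0 θ1 θ2 l) ^ (-(1 + α)))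
            ≤ C * (minIdx hd M : ℝ) ^ (-(2 * (1 + α) - (d : ℝ))))
          ∧ (2 * (1 + α) - (d : ℝ) = 2 →
            (∑' l : Fin d → ℕ+,
              (eFun (fun k => (l k : ℕ)) (fun k => θ1 k / θ2) y
                - eFun (fun k => (l k : ℕ)) (fun k => θ1 k / θ2) z) ^ 2
              * (lamOf θ0 θ1 θ2 l) ^ (-(1 + α)))
            ≤ C * Real.log (1 + (minIdx hd M : ℝ)) * (minIdx hd M : ℝ) ^ (-(2 : ℝ)))
          ∧ (2 < 2 * (1 + α) - (d : ℝ) →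
            (∑' l : Fin d → ℕ+,
              (eFun (fun k => (l k : ℕ)) (fun k => θ1 k / θ2) y
                - eFun (fun k => (l k : ℕ)) (fun k => θ1 k / θ2) z) ^ 2
              * (lamOf θ0 θ1 θ2 l) ^ (-(1 + α)))
            ≤ C * (minIdx hd M : ℝ) ^ (-(2 : ℝ)))) := by
  set γ : ℝ := 2 * (1 + α) - (d : ℝ) with hγdef
  have hγ : 0 < γ := by rw [hγdef]; linarith
  obtain ⟨K, hK, hE⟩ := exists_sq_eFun_sub_le hd (fun k => θ1 k / θ2)
  obtain ⟨c, hc, hlam⟩ := exists_mul_sq_le_lamOf hd hθ2 hpos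
  obtain ⟨C, hC, hS⟩ := exists_sum_min_mul_rpow_le hγ
  have hd0 : (0 : ℝ) < d := by exact_mod_cast hd
  have hD : 0 < d * K * c ^ (-(1 + α)) := by positivity
  refine ⟨d * K * c ^ (-(1 + α)) * C, by positivity, fun M hM j hj y z hy hz => ?_⟩
  set m : ℕ := minIdx hd M with hm
  have hmle : ∀ k, m ≤ M k := fun k => Finset.inf'_le M (Finset.mem_univ k)
  have hm1 : 1 ≤ m := Finset.le_inf' _ _ fun k _ => hM k
  have hm0 : (0 : ℝ) < m := by exact_mod_cast hm1
  have hM0 : ∀ k, (0 : ℝ) < M k := fun k => by exact_mod_cast hM k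
  have hunit : ∀ w : Fin d → ℝ,
      (∀ k, w k ∈ Set.Icc (((j k : ℝ) - 1) / (M k : ℝ)) ((j k : ℝ) / (M k : ℝ))) →
      ∀ k, |w k| ≤ 1 := by
    intro w hw k
    have h1 : (1 : ℝ) ≤ j k := by exact_mod_cast (hj k).1
    have h2 : (j k : ℝ) ≤ M k := by exact_mod_cast (hj k).2
    have h3 : 0 ≤ ((j k : ℝ) - 1) / (M k : ℝ) := div_nonneg (by linarith) (hM0 k).le
    have h4 : (j k : ℝ) / (M k : ℝ) ≤ 1 := (div_le_one (hM0 k)).mpr h2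
    rw [abs_le]
    constructor <;> linarith [(hw k).1, (hw k).2]
  have hyz : ∀ k, |y k - z k| ≤ 1 / m := by
    intro k
    refine (abs_sub_le_of_le_of_le (hy k).1 (hy k).2 (hz k).1 (hz k).2).trans ?_
    have h1 : (m : ℝ) ≤ M k := by exact_mod_cast hmle k
    calc _ = 1 / (M k : ℝ) := by ring
      _ ≤ 1 / (m : ℝ) := one_div_le_one_div_of_le hm0 h1
  obtain ⟨B, hB, hB1, hB2, hB3⟩ := hS m hm1
  set F : (Fin d → ℕ+) → ℝ := fun l =>
    (eFun (fun k => (l k : ℕ)) (fun k => θ1 k / θ2) y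
      - eFun (fun k => (l k : ℕ)) (fun k => θ1 k / θ2) z) ^ 2
    * (lamOf θ0 θ1 θ2 l) ^ (-(1 + α)) with hF
  set g : ℕ → ℝ := fun n =>
    K * min 1 ((n : ℝ) ^ 2 / (m : ℝ) ^ 2) * (c * (n : ℝ) ^ 2) ^ (-(1 + α)) with hg
  have hg0 : ∀ n, 0 ≤ g n := fun n => by simp only [hg]; positivity
  have hlam0 : ∀ l : Fin d → ℕ+, 0 < c * (maxEntry l : ℝ) ^ 2 := fun l => by
    have : (0 : ℝ) < maxEntry l := by exact_mod_cast one_le_maxEntry hd l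
    positivity
  have hF0 : 0 ≤ F := fun l => mul_nonneg (sq_nonneg _)
    (Real.rpow_nonneg ((hlam0 l).le.trans (hlam l)) _)
  have hFg : ∀ l, F l ≤ g (maxEntry l) := fun l =>
    mul_le_mul (hE m hm1 l y z (hunit y hy) (hunit z hz) hyz)
      (Real.rpow_le_rpow_of_nonpos (hlam0 l) (hlam l) (by linarith))
      (Real.rpow_nonneg ((hlam0 l).le.trans (hlam l)) _) (by positivity)
  have hsum : ∀ u : Finset (Fin d → ℕ+), ∑ l ∈ u, F l ≤ d * K * c ^ (-(1 + α)) * B := by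
    intro u
    obtain ⟨N, hN⟩ := exists_sum_maxEntry_le hd u hg0
    refine (Finset.sum_le_sum fun l _ => hFg l).trans (hN.trans ?_)
    refine le_trans (le_of_eq ?_) (mul_le_mul_of_nonneg_left (hB N) hD.le)
    rw [Finset.mul_sum]
    refine Finset.sum_congr rfl fun n hn => ?_
    have hn0 : (0 : ℝ) < n := by exact_mod_cast (Finset.mem_Icc.mp hn).1
    have h1 : (n : ℝ) ^ (-1 - γ) = (n : ℝ) ^ (d - 1) * ((n : ℝ) ^ 2) ^ (-(1 + α)) := by
      rw [← Real.rpow_natCast _ (d - 1), ← Real.rpow_two, ← Real.rpow_mul hn0.le,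
        ← Real.rpow_add hn0, Nat.cast_sub hd, hγdef]
      congr 1
      push_cast
      ring
    simp only [hg]
    rw [h1, Real.mul_rpow hc.le (by positivity)]
    ring
  have hts := Real.tsum_le_of_sum_le hF0 hsum
  refine ⟨summable_of_sum_le hF0 hsum, fun h => ?_, fun h => ?_, fun h => ?_⟩
  · refine hts.trans ((mul_le_mul_of_nonneg_left (hB1 h) hD.le).trans_eq ?_)
    ring
  · refine hts.trans ((mul_le_mul_of_nonneg_left (hB2 h) hD.le).trans_eq ?_)
    ring
  · refine hts.trans ((mul_le_mul_of_nonneg_left (hB3 h) hD.le).trans_eq ?_)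
    ring
end

section
/- For every x > 0, the two series representations of the Kolmogorov distribution function agree: 1 − 2 ∑_{n=1}^∞ (−1)^{n−1} exp(−2 n² x²) = (√(2π)/x) ∑_{n=1}^∞ exp( −(2n−1)² π² / (8 x²) ). -/
open Complex in
/-- Poisson summation for the alternating Gaussian sum over `ℤ`. -/
lemma tsum_int_alternating_gaussian {x : ℝ} (hx : 0 < x) :
    ∑' n : ℤ, (-1 : ℝ) ^ n * Real.exp (-2 * (n : ℝ) ^ 2 * x ^ 2)
      = Real.sqrt (2 * Real.pi) / (2 * x) *
          ∑' n : ℤ, Real.exp (-((2 * (n : ℝ) + 1) ^ 2 * Real.pi ^ 2) / (8 * x ^ 2)) := by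
  have hpi : (Real.pi : ℂ) ≠ 0 := ofReal_ne_zero.mpr Real.pi_ne_zero
  have hxc : (x : ℂ) ≠ 0 := ofReal_ne_zero.mpr hx.ne'
  have ha : 0 < 2 * x ^ 2 / Real.pi := by positivity
  have key := tsum_exp_neg_quadratic (a := ((2 * x ^ 2 / Real.pi : ℝ) : ℂ))
    (by rwa [ofReal_re]) (-I / 2)
  have hroot : 1 / (2 * x ^ 2 / Real.pi) ^ (1 / 2 : ℝ) = Real.sqrt (2 * Real.pi) / (2 * x) := by
    rw [← Real.sqrt_eq_rpow, Real.sqrt_div (by positivity), Real.sqrt_mul zero_le_two,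
      Real.sqrt_sq hx.le, Real.sqrt_mul zero_le_two]
    have h2 : Real.sqrt 2 ≠ 0 := by positivity
    have hp : Real.sqrt Real.pi ≠ 0 := by positivity
    field_simp
    rw [Real.sq_sqrt zero_le_two]
  have hleft (n : ℤ) : cexp (-Real.pi * ((2 * x ^ 2 / Real.pi : ℝ) : ℂ) * n ^ 2
      + 2 * Real.pi * (-I / 2) * n)
      = (((-1 : ℝ) ^ n * Real.exp (-2 * (n : ℝ) ^ 2 * x ^ 2) : ℝ) : ℂ) := by
    have harg : -(Real.pi : ℂ) * ((2 * x ^ 2 / Real.pi : ℝ) : ℂ) * n ^ 2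
        + 2 * Real.pi * (-I / 2) * n
        = n * (-(Real.pi * I)) + ((-2 * (n : ℝ) ^ 2 * x ^ 2 : ℝ) : ℂ) := by
      push_cast
      field_simp
      ring
    rw [harg, Complex.exp_add, exp_int_mul, Complex.exp_neg, exp_pi_mul_I]
    push_cast
    norm_num
  have hright (n : ℤ) : cexp (-Real.pi / ((2 * x ^ 2 / Real.pi : ℝ) : ℂ) * (n + I * (-I / 2)) ^ 2)
      = ((Real.exp (-((2 * (n : ℝ) + 1) ^ 2 * Real.pi ^ 2) / (8 * x ^ 2)) : ℝ) : ℂ) := by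
    rw [ofReal_exp, show I * (-I / 2) = 1 / 2 by linear_combination (-1 / 2 : ℂ) * I_mul_I]
    congr 1
    push_cast
    field_simp
    ring
  rw [tsum_congr hleft, tsum_congr hright, ← ofReal_tsum, ← ofReal_tsum,
    show (1 / 2 : ℂ) = ((1 / 2 : ℝ) : ℂ) by push_cast; rfl, ← ofReal_cpow ha.le] at key
  rw [← hroot]
  exact_mod_cast key

/-- A sequence `exp (-c * g n)` is summable when `c > 0` and `g n ≥ n`. -/
lemma summable_exp_neg_mul_of_le {c : ℝ} (hc : 0 < c) {g : ℕ → ℝ} (hg : ∀ n : ℕ, (n : ℝ) ≤ g n) :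
    Summable fun n ↦ Real.exp (-c * g n) := by
  refine (Real.summable_exp_nat_mul_iff.mpr (neg_lt_zero.mpr hc)).of_nonneg_of_le
    (fun n ↦ (Real.exp_pos _).le) fun n ↦ Real.exp_le_exp.mpr ?_
  nlinarith [hg n]

/-- the two series representations of the Kolmogorov distribution function agree:
`1 − 2 ∑_{n≥1} (−1)^{n−1} e^{−2n²x²} = (√(2π)/x) ∑_{n≥1} e^{−(2n−1)²π²/(8x²)}` for `x > 0`. -/
theorem stmt11 (x : ℝ) (hx : 0 < x) :
    1 - 2 * ∑' n : ℕ, (-1 : ℝ) ^ n * Real.exp (-2 * ((n : ℝ) + 1) ^ 2 * x ^ 2)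
      = Real.sqrt (2 * Real.pi) / x *
          ∑' n : ℕ, Real.exp (-((2 * (n : ℝ) + 1) ^ 2 * Real.pi ^ 2) / (8 * x ^ 2)) := by
  have hS : Summable fun n : ℕ ↦ (-1 : ℝ) ^ n * Real.exp (-2 * ((n : ℝ) + 1) ^ 2 * x ^ 2) := by
    refine Summable.of_norm ((summable_exp_neg_mul_of_le (c := 2 * x ^ 2)
      (g := fun n : ℕ ↦ ((n : ℝ) + 1) ^ 2) (by positivity) fun n ↦ by
        nlinarith [(Nat.cast_nonneg n : (0 : ℝ) ≤ n)]).congr fun n ↦ ?_)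
    simp only [norm_mul, norm_pow, norm_neg, norm_one, one_pow, one_mul, Real.norm_eq_abs,
      Real.abs_exp]
    ring_nf
  have hT : Summable fun n : ℕ ↦
      Real.exp (-((2 * (n : ℝ) + 1) ^ 2 * Real.pi ^ 2) / (8 * x ^ 2)) := by
    refine (summable_exp_neg_mul_of_le (c := Real.pi ^ 2 / (8 * x ^ 2))
      (g := fun n : ℕ ↦ (2 * (n : ℝ) + 1) ^ 2) (by positivity) fun n ↦ by
        nlinarith [(Nat.cast_nonneg n : (0 : ℝ) ≤ n)]).congr fun n ↦ ?_
    ring_nf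
  have hleft : ∑' n : ℤ, (-1 : ℝ) ^ n * Real.exp (-2 * (n : ℝ) ^ 2 * x ^ 2)
      = 1 - 2 * ∑' n : ℕ, (-1 : ℝ) ^ n * Real.exp (-2 * ((n : ℝ) + 1) ^ 2 * x ^ 2) := by
    have hsucc (n : ℕ) : (-1 : ℝ) ^ (n + 1) * Real.exp (-2 * ((n + 1 : ℕ) : ℝ) ^ 2 * x ^ 2)
        = -((-1 : ℝ) ^ n * Real.exp (-2 * ((n : ℝ) + 1) ^ 2 * x ^ 2)) := by
      push_cast
      ring
    have hneg (n : ℕ) : (-1 : ℝ) ^ (-((n : ℤ) + 1))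
          * Real.exp (-2 * ((-((n : ℤ) + 1) : ℤ) : ℝ) ^ 2 * x ^ 2)
        = -((-1 : ℝ) ^ n * Real.exp (-2 * ((n : ℝ) + 1) ^ 2 * x ^ 2)) := by
      rw [← hsucc, zpow_neg, ← inv_zpow, inv_neg_one]
      push_cast
      rw [neg_sq]
      norm_cast
    have hnat : HasSum (fun n : ℕ ↦ (-1 : ℝ) ^ (n : ℤ)
        * Real.exp (-2 * (((n : ℤ)) : ℝ) ^ 2 * x ^ 2))
        (-(∑' n : ℕ, (-1 : ℝ) ^ n * Real.exp (-2 * ((n : ℝ) + 1) ^ 2 * x ^ 2)) + 1) := by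
      simp only [zpow_natCast, Int.cast_natCast]
      have h := (hasSum_nat_add_iff (f := fun n : ℕ ↦ (-1 : ℝ) ^ n
        * Real.exp (-2 * (n : ℝ) ^ 2 * x ^ 2)) 1).mp
        ((funext hsucc : _ = _) ▸ hS.hasSum.neg)
      simpa using h
    rw [(hnat.of_nat_of_neg_add_one ((funext hneg : _ = _) ▸ hS.hasSum.neg)).tsum_eq]
    ring
  have hright : ∑' n : ℤ, Real.exp (-((2 * (n : ℝ) + 1) ^ 2 * Real.pi ^ 2) / (8 * x ^ 2))
      = 2 * ∑' n : ℕ, Real.exp (-((2 * (n : ℝ) + 1) ^ 2 * Real.pi ^ 2) / (8 * x ^ 2)) := by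
    have hneg (n : ℕ) : Real.exp (-((2 * ((-((n : ℤ) + 1) : ℤ) : ℝ) + 1) ^ 2 * Real.pi ^ 2)
        / (8 * x ^ 2)) = Real.exp (-((2 * (n : ℝ) + 1) ^ 2 * Real.pi ^ 2) / (8 * x ^ 2)) := by
      push_cast
      ring_nf
    rw [tsum_of_nat_of_neg_add_one (by simpa only [Int.cast_natCast] using hT)
      (hT.congr fun n ↦ (hneg n).symm), tsum_congr hneg, two_mul]
    simp only [Int.cast_natCast]
  rw [← hleft, tsum_int_alternating_gaussian hx, hright]
  field_simp
end
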